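/- Under the Kähler identities, the natural maps induced by the identity between the cohomologies are all isomorphisms: with d := ∂ + ∂̄, H_BC := (ker ∂ ∩ ker ∂̄)/im(∂∘∂̄), H_A := ker(∂∘∂̄)/(im ∂ + im ∂̄), H_∂ := ker ∂/im ∂, H_∂̄ := ker ∂̄/im ∂̄ and H_d := ker d/im d, the natural maps H_BC → H_∂, H_BC → H_∂̄, H_BC → H_d, H_BC → H_A, H_∂ → H_A, H_∂̄ → H_A and H_d → H_A are all linear isomorphisms. -/

import Mathlib

open LinearMap Submodule

section

variable {K V : Type*} [Field K] [AddCommGroup V] [Module K V]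

/-- Bott–Chern cocycles: `ker ∂ ∩ ker ∂̄`. -/
def ZBC (p q : V →ₗ[K] V) : Submodule K V := ker p ⊓ ker q

/-- Bott–Chern coboundaries: `im (∂∘∂̄)`. -/
def BBC (p q : V →ₗ[K] V) : Submodule K V := range (p ∘ₗ q)

/-- Aeppli cocycles: `ker (∂∘∂̄)`. -/
def ZA (p q : V →ₗ[K] V) : Submodule K V := ker (p ∘ₗ q)

/-- Aeppli coboundaries: `im ∂ + im ∂̄`. -/
def BA (p q : V →ₗ[K] V) : Submodule K V := range p ⊔ range q

/-- Bott–Chern cohomology `(ker ∂ ∩ ker ∂̄)/im(∂∘∂̄)`. -/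
abbrev HBC (p q : V →ₗ[K] V) := ↥(ZBC p q) ⧸ ((BBC p q).comap (ZBC p q).subtype)

/-- Aeppli cohomology `ker(∂∘∂̄)/(im ∂ + im ∂̄)`. -/
abbrev HA (p q : V →ₗ[K] V) := ↥(ZA p q) ⧸ ((BA p q).comap (ZA p q).subtype)

/-- `∂`-cohomology `ker ∂ / im ∂`. -/
abbrev Hdel (p : V →ₗ[K] V) := ↥(ker p) ⧸ ((range p).comap (ker p).subtype)

/-- de Rham cohomology `ker d / im d` for `d = ∂ + ∂̄`. -/
abbrev Hd (p q : V →ₗ[K] V) :=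
  ↥(ker (p + q)) ⧸ ((range (p + q)).comap (ker (p + q)).subtype)

theorem ZBC_le_ZA (p q : V →ₗ[K] V) : ZBC p q ≤ ZA p q := by
  intro x hx
  obtain ⟨h1, h2⟩ := Submodule.mem_inf.mp hx
  simp only [ZA, mem_ker, comp_apply] at *
  rw [h2, map_zero]

theorem BBC_le_BA (p q : V →ₗ[K] V) : BBC p q ≤ BA p q := by
  rintro x ⟨u, rfl⟩
  exact Submodule.mem_sup_left ⟨q u, rfl⟩

/-- The natural map `H_BC → H_A` induced by the identity. -/
def iotaBCA (p q : V →ₗ[K] V) : HBC p q →ₗ[K] HA p q :=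
  Submodule.liftQ _
    ((Submodule.mkQ _) ∘ₗ Submodule.inclusion (ZBC_le_ZA p q)) (by
      intro y hy
      rw [Submodule.mem_comap] at hy
      simp only [LinearMap.mem_ker, LinearMap.comp_apply, Submodule.mkQ_apply,
        Submodule.Quotient.mk_eq_zero, Submodule.mem_comap]
      exact BBC_le_BA p q hy)

/-- The natural map `H_BC → H_∂` induced by the identity. -/
def iotaBCdel (p q : V →ₗ[K] V) : HBC p q →ₗ[K] Hdel p :=
  Submodule.liftQ _
    ((Submodule.mkQ _) ∘ₗ Submodule.inclusion (inf_le_left : ZBC p q ≤ ker p)) (by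
      intro y hy
      rw [Submodule.mem_comap] at hy
      simp only [LinearMap.mem_ker, LinearMap.comp_apply, Submodule.mkQ_apply,
        Submodule.Quotient.mk_eq_zero, Submodule.mem_comap]
      obtain ⟨u, hu⟩ := hy
      exact ⟨q u, hu⟩)

/-- The natural map `H_BC → H_∂̄` induced by the identity. -/
def iotaBCdelbar (p q : V →ₗ[K] V) (hpq : p ∘ₗ q + q ∘ₗ p = 0) :
    HBC p q →ₗ[K] Hdel q :=
  Submodule.liftQ _
    ((Submodule.mkQ _) ∘ₗ Submodule.inclusion (inf_le_right : ZBC p q ≤ ker q)) (by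
      intro y hy
      rw [Submodule.mem_comap] at hy
      simp only [LinearMap.mem_ker, LinearMap.comp_apply, Submodule.mkQ_apply,
        Submodule.Quotient.mk_eq_zero, Submodule.mem_comap]
      obtain ⟨u, hu⟩ := hy
      refine ⟨-(p u), ?_⟩
      have h2 : p (q u) + q (p u) = 0 := by
        have := LinearMap.congr_fun hpq u; simpa using this
      have hu' : p (q u) = (y : V) := hu
      show q (-(p u)) = (y : V)
      rw [map_neg, ← hu']
      exact neg_eq_of_add_eq_zero_left h2)

theorem ZBC_le_kerd (p q : V →ₗ[K] V) : ZBC p q ≤ ker (p + q) := by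
  intro x hx
  obtain ⟨h1, h2⟩ := Submodule.mem_inf.mp hx
  rw [LinearMap.mem_ker] at h1 h2 ⊢
  simp [LinearMap.add_apply, h1, h2]

theorem BBC_le_ranged (p q : V →ₗ[K] V) (hq : q ∘ₗ q = 0) :
    BBC p q ≤ range (p + q) := by
  rintro x ⟨u, rfl⟩
  refine ⟨q u, ?_⟩
  have hqq : q (q u) = 0 := by
    have := LinearMap.congr_fun hq u; simpa using this
  simp [LinearMap.add_apply, hqq]

/-- The natural map `H_BC → H_dR` induced by the identity. -/
def iotaBCd (p q : V →ₗ[K] V) (hq : q ∘ₗ q = 0) : HBC p q →ₗ[K] Hd p q :=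
  Submodule.liftQ _
    ((Submodule.mkQ _) ∘ₗ Submodule.inclusion (ZBC_le_kerd p q)) (by
      intro y hy
      rw [Submodule.mem_comap] at hy
      simp only [LinearMap.mem_ker, LinearMap.comp_apply, Submodule.mkQ_apply,
        Submodule.Quotient.mk_eq_zero, Submodule.mem_comap]
      exact BBC_le_ranged p q hq hy)

theorem kerdel_le_ZA (p q : V →ₗ[K] V) (hpq : p ∘ₗ q + q ∘ₗ p = 0) :
    ker p ≤ ZA p q := by
  intro x hx
  rw [LinearMap.mem_ker] at hx
  have h2 : p (q x) + q (p x) = 0 := by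
    have := LinearMap.congr_fun hpq x; simpa using this
  have : p (q x) = 0 := by rw [hx, map_zero, add_zero] at h2; exact h2
  simpa [ZA, LinearMap.mem_ker] using this

theorem kerdelbar_le_ZA (p q : V →ₗ[K] V) : ker q ≤ ZA p q := by
  intro x hx
  rw [LinearMap.mem_ker] at hx
  simp [ZA, LinearMap.mem_ker, hx]

/-- The natural map `H_∂ → H_A` induced by the identity. -/
def iotadelA (p q : V →ₗ[K] V) (hpq : p ∘ₗ q + q ∘ₗ p = 0) :
    Hdel p →ₗ[K] HA p q :=
  Submodule.liftQ _
    ((Submodule.mkQ _) ∘ₗ Submodule.inclusion (kerdel_le_ZA p q hpq)) (by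
      intro y hy
      rw [Submodule.mem_comap] at hy
      simp only [LinearMap.mem_ker, LinearMap.comp_apply, Submodule.mkQ_apply,
        Submodule.Quotient.mk_eq_zero, Submodule.mem_comap]
      exact Submodule.mem_sup_left hy)

/-- The natural map `H_∂̄ → H_A` induced by the identity. -/
def iotadelbarA (p q : V →ₗ[K] V) : Hdel q →ₗ[K] HA p q :=
  Submodule.liftQ _
    ((Submodule.mkQ _) ∘ₗ Submodule.inclusion (kerdelbar_le_ZA p q)) (by
      intro y hy
      rw [Submodule.mem_comap] at hy
      simp only [LinearMap.mem_ker, LinearMap.comp_apply, Submodule.mkQ_apply,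
        Submodule.Quotient.mk_eq_zero, Submodule.mem_comap]
      exact Submodule.mem_sup_right hy)

theorem kerd_le_ZA (p q : V →ₗ[K] V) (hp : p ∘ₗ p = 0) : ker (p + q) ≤ ZA p q := by
  intro x hx
  rw [LinearMap.mem_ker] at hx
  have hqx : q x = -(p x) := by
    have : p x + q x = 0 := by simpa using hx
    exact eq_neg_of_add_eq_zero_right this
  have hpp : p (p x) = 0 := by
    have := LinearMap.congr_fun hp x; simpa using this
  have : p (q x) = 0 := by rw [hqx, map_neg, hpp, neg_zero]
  simpa [ZA, LinearMap.mem_ker] using this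

theorem ranged_le_BA (p q : V →ₗ[K] V) : range (p + q) ≤ BA p q := by
  rintro x ⟨u, rfl⟩
  have : (p + q) u = p u + q u := rfl
  rw [this]
  exact Submodule.add_mem _ (Submodule.mem_sup_left ⟨u, rfl⟩)
    (Submodule.mem_sup_right ⟨u, rfl⟩)

/-- The natural map `H_dR → H_A` induced by the identity. -/
def iotadA (p q : V →ₗ[K] V) (hp : p ∘ₗ p = 0) : Hd p q →ₗ[K] HA p q :=
  Submodule.liftQ _
    ((Submodule.mkQ _) ∘ₗ Submodule.inclusion (kerd_le_ZA p q hp)) (by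
      intro y hy
      rw [Submodule.mem_comap] at hy
      simp only [LinearMap.mem_ker, LinearMap.comp_apply, Submodule.mkQ_apply,
        Submodule.Quotient.mk_eq_zero, Submodule.mem_comap]
      exact ranged_le_BA p q hy)

end

theorem kahler_core {V : Type*} [NormedAddCommGroup V] [InnerProductSpace ℂ V]
    [FiniteDimensional ℂ V]
    (p q Lam : V →ₗ[ℂ] V)
    (hp : p ∘ₗ p = 0) (hq : q ∘ₗ q = 0) (hpq : p ∘ₗ q + q ∘ₗ p = 0)
    (hk1 : Lam ∘ₗ p - p ∘ₗ Lam = Complex.I • LinearMap.adjoint q)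
    (hk2 : Lam ∘ₗ q - q ∘ₗ Lam = (-Complex.I) • LinearMap.adjoint p) :
    (∀ x, p x = 0 → q x = 0 → x ∈ BA p q → x ∈ BBC p q) ∧
    (∀ x, p (q x) = 0 → ∃ z u v, p z = 0 ∧ q z = 0 ∧ x = z + p u + q v) := by
  set P := LinearMap.adjoint p with hP
  set Q := LinearMap.adjoint q with hQ
  have hpp : ∀ x, p (p x) = 0 := fun x => LinearMap.congr_fun hp x
  have hqq : ∀ x, q (q x) = 0 := fun x => LinearMap.congr_fun hq x
  have hqp : ∀ x, q (p x) = - p (q x) := fun x =>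
    eq_neg_of_add_eq_zero_right (LinearMap.congr_fun hpq x)
  have hPa : ∀ x y, inner ℂ (P x) y = inner ℂ x (p y) := fun x y =>
    LinearMap.adjoint_inner_left p y x
  have hQa : ∀ x y, inner ℂ (Q x) y = inner ℂ x (q y) := fun x y =>
    LinearMap.adjoint_inner_left q y x
  have hPP : ∀ x, P (P x) = 0 := by
    intro x
    refine ext_inner_right ℂ fun v => ?_
    rw [hPa, hPa, hpp]; simp
  have hQQ : ∀ x, Q (Q x) = 0 := by
    intro x
    refine ext_inner_right ℂ fun v => ?_
    rw [hQa, hQa, hqq]; simp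
  have hQf : ∀ x, Q x = (-Complex.I) • (Lam (p x) - p (Lam x)) := by
    intro x
    have h := LinearMap.congr_fun hk1 x
    simp only [LinearMap.sub_apply, LinearMap.comp_apply, LinearMap.smul_apply] at h
    rw [h, smul_smul]; simp
  have hPf : ∀ x, P x = Complex.I • (Lam (q x) - q (Lam x)) := by
    intro x
    have h := LinearMap.congr_fun hk2 x
    simp only [LinearMap.sub_apply, LinearMap.comp_apply, LinearMap.smul_apply] at h
    rw [h, smul_smul]; simp
  have hpQ : ∀ x, p (Q x) = - Q (p x) := by
    intro x
    rw [hQf, hQf]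
    simp [hpp]
  have hqP : ∀ x, q (P x) = - P (q x) := by
    intro x
    rw [hPf, hPf]
    simp [hqq]
  have hPQ : ∀ x, P (Q x) = - Q (P x) := by
    intro x
    refine ext_inner_right ℂ fun v => ?_
    rw [inner_neg_left, hPa, hQa, hQa, hPa, hqp]; simp
  have hlap : ∀ x, p (P x) + P (p x) = q (Q x) + Q (q x) := by
    intro x
    rw [hPf, hPf, hQf, hQf]
    simp only [map_smul, map_sub, hqp, map_neg]
    module
  let D : V →ₗ[ℂ] V := p ∘ₗ P + P ∘ₗ p
  have hD : ∀ x, D x = p (P x) + P (p x) := fun x => rfl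
  have hD' : ∀ x, D x = q (Q x) + Q (q x) := fun x => hlap x
  have hDs : ∀ x y, inner ℂ (D x) y = inner ℂ x (D y) := by
    intro x y
    have hPb : ∀ x y, inner ℂ (p x) y = inner ℂ x (P y) := fun x y =>
      (LinearMap.adjoint_inner_right p x y).symm
    rw [hD, hD, inner_add_left, inner_add_right, hPa, hPb, hPa, hPb]
  have hH1 : ∀ x, D x = 0 → p x = 0 ∧ P x = 0 := by
    intro x hx
    have hPb : inner ℂ (p (P x)) x = inner ℂ (P x) (P x) :=
      (LinearMap.adjoint_inner_right p (P x) x).symm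
    have h : inner ℂ (D x) x = (0 : ℂ) := by rw [hx]; simp
    rw [hD, inner_add_left, hPb, hPa (p x), inner_self_eq_norm_sq_to_K,
      inner_self_eq_norm_sq_to_K] at h
    have h2 : ‖P x‖ ^ 2 + ‖p x‖ ^ 2 = 0 := by
      apply Complex.ofReal_injective
      push_cast
      exact h
    constructor <;> rw [← norm_eq_zero] <;> nlinarith [sq_nonneg ‖P x‖, sq_nonneg ‖p x‖]
  have hH2 : ∀ x, D x = 0 → q x = 0 ∧ Q x = 0 := by
    intro x hx
    have hPb : inner ℂ (q (Q x)) x = inner ℂ (Q x) (Q x) :=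
      (LinearMap.adjoint_inner_right q (Q x) x).symm
    have h : inner ℂ (D x) x = (0 : ℂ) := by rw [hx]; simp
    rw [hD', inner_add_left, hPb, hQa (q x), inner_self_eq_norm_sq_to_K,
      inner_self_eq_norm_sq_to_K] at h
    have h2 : ‖Q x‖ ^ 2 + ‖q x‖ ^ 2 = 0 := by
      apply Complex.ofReal_injective
      push_cast
      exact h
    constructor <;> rw [← norm_eq_zero] <;> nlinarith [sq_nonneg ‖Q x‖, sq_nonneg ‖q x‖]
  have hDp : ∀ y, p (D y) = D (p y) := by
    intro y; simp [hD, hpp]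
  have hDq : ∀ y, q (D y) = D (q y) := by
    intro y; simp [hD', hqq]
  have hp0 : ∀ y, D (p y) = 0 → p y = 0 := by
    intro y hy
    have h := (hH1 _ hy).2
    rw [← inner_self_eq_zero (𝕜 := ℂ), ← hPa, h]; simp
  have hq0 : ∀ y, D (q y) = 0 → q y = 0 := by
    intro y hy
    have h := (hH2 _ hy).2
    rw [← inner_self_eq_zero (𝕜 := ℂ), ← hQa, h]; simp
  have hdec : ∀ x, ∃ h y, D h = 0 ∧ x = h + D y := by
    intro x
    obtain ⟨a, ⟨y, hy⟩, b, hb, hx⟩ := (LinearMap.range D).exists_add_mem_mem_orthogonal x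
    refine ⟨b, y, ?_, by rw [hx, ← hy, add_comm]⟩
    rw [← inner_self_eq_zero (𝕜 := ℂ), ← hDs]
    exact (Submodule.mem_orthogonal _ _).1 hb _ ⟨D b, rfl⟩ 
  have key_p : ∀ x h y, D h = 0 → x = h + D y → p x = 0 → p y = 0 := by
    intro x h y hh hx h0
    apply hp0
    rw [hx, map_add, (hH1 h hh).1, zero_add, hDp] at h0
    exact h0
  have key_q : ∀ x h y, D h = 0 → x = h + D y → q x = 0 → q y = 0 := by
    intro x h y hh hx h0
    apply hq0
    rw [hx, map_add, (hH2 h hh).1, zero_add, hDq] at h0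
    exact h0
  constructor
  · intro x hpx hqx hx
    obtain ⟨h, y, hh, hxy⟩ := hdec x
    have hpy := key_p x h y hh hxy hpx
    have hqy := key_q x h y hh hxy hqx
    obtain ⟨h', z, hh', hz⟩ := hdec (P y)
    have hqz := key_q _ h' z hh' hz (by rw [hqP, hqy]; simp)
    have e : D y = p (q (Q z)) := by
      rw [hD, hpy, map_zero, add_zero, hz, map_add, (hH1 h' hh').1, zero_add, hD', hqz,
        map_zero, add_zero]
    have h0 : h = 0 := by
      obtain ⟨a, ⟨u, hu⟩, b, ⟨v, hv⟩, hab⟩ := Submodule.mem_sup.1 hx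
      have : h = p (u - q (Q z)) + q v := by
        rw [map_sub, hu, hv, ← e, sub_add_eq_add_sub, hab, hxy]; simp
      rw [← inner_self_eq_zero (𝕜 := ℂ)]
      nth_rewrite 2 [this]
      rw [inner_add_right, ← hPa, ← hQa, (hH1 h hh).2, (hH2 h hh).2]; simp
    exact ⟨Q z, by rw [hxy, h0, zero_add, e]; rfl⟩
  · intro x hx
    obtain ⟨h, y, hh, hxy⟩ := hdec x
    have hqpy : q (p y) = 0 := by
      apply hq0
      rw [← hDq, ← hDp]
      have : D y = x - h := by rw [hxy]; simp
      rw [this, map_sub, (hH1 h hh).1, sub_zero, hqp, hx, neg_zero]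
    obtain ⟨h', z, hh', hz⟩ := hdec (p y)
    have hqz := key_q _ h' z hh' hz hqpy
    refine ⟨h, P y, -(P (Q z)), (hH1 h hh).1, (hH2 h hh).1, ?_⟩
    rw [map_neg, hqP, neg_neg, hxy, hD, hz, map_add P, (hH1 h' hh').2, zero_add, hD', hqz,
      map_zero, add_zero, add_assoc]

/-- Bijectivity criterion for a map of subquotients induced by the identity. -/
theorem bij_subquot {K V : Type*} [Field K] [AddCommGroup V] [Module K V]
    {Z B Z' B' : Submodule K V} (hZ : Z ≤ Z')
    (hle : B.comap Z.subtype ≤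
      LinearMap.ker ((B'.comap Z'.subtype).mkQ ∘ₗ Submodule.inclusion hZ))
    (hi : ∀ x ∈ Z, x ∈ B' → x ∈ B)
    (hs : ∀ x ∈ Z', ∃ z ∈ Z, x - z ∈ B') :
    Function.Bijective (Submodule.liftQ (B.comap Z.subtype)
      ((B'.comap Z'.subtype).mkQ ∘ₗ Submodule.inclusion hZ) hle) := by
  constructor
  · rw [← LinearMap.ker_eq_bot, LinearMap.ker_eq_bot']
    intro m hm
    obtain ⟨z, rfl⟩ := Submodule.mkQ_surjective _ m
    simp only [Submodule.mkQ_apply, Submodule.liftQ_apply, LinearMap.comp_apply,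
      Submodule.Quotient.mk_eq_zero, Submodule.mem_comap] at hm ⊢
    exact hi _ z.2 hm
  · intro m
    obtain ⟨x, rfl⟩ := Submodule.mkQ_surjective _ m
    obtain ⟨z, hz, hxz⟩ := hs x x.2
    refine ⟨Submodule.mkQ _ ⟨z, hz⟩, ?_⟩
    simp only [Submodule.mkQ_apply, Submodule.liftQ_apply, LinearMap.comp_apply]
    symm
    rw [Submodule.Quotient.eq]
    exact hxz

/-- Under the Kähler identities, all the natural maps induced by the identity
between the Bott–Chern, Dolbeault, de Rham and Aeppli cohomologies are
isomorphisms. -/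
theorem stmt17 {V : Type*} [NormedAddCommGroup V] [InnerProductSpace ℂ V]
    [FiniteDimensional ℂ V]
    (p q Lam : V →ₗ[ℂ] V)
    (hp : p ∘ₗ p = 0) (hq : q ∘ₗ q = 0) (hpq : p ∘ₗ q + q ∘ₗ p = 0)
    (hk1 : Lam ∘ₗ p - p ∘ₗ Lam = Complex.I • LinearMap.adjoint q)
    (hk2 : Lam ∘ₗ q - q ∘ₗ Lam = (-Complex.I) • LinearMap.adjoint p) :
    Function.Bijective (iotaBCdel p q) ∧
    Function.Bijective (iotaBCdelbar p q hpq) ∧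
    Function.Bijective (iotaBCd p q hq) ∧
    Function.Bijective (iotaBCA p q) ∧
    Function.Bijective (iotadelA p q hpq) ∧
    Function.Bijective (iotadelbarA p q) ∧
    Function.Bijective (iotadA p q hp) := by
  obtain ⟨hL, hA⟩ := kahler_core p q Lam hp hq hpq hk1 hk2
  have hpp : ∀ x, p (p x) = 0 := fun x => LinearMap.congr_fun hp x
  have hqq : ∀ x, q (q x) = 0 := fun x => LinearMap.congr_fun hq x
  have hqp : ∀ x, q (p x) = - p (q x) := fun x =>
    eq_neg_of_add_eq_zero_right (LinearMap.congr_fun hpq x)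
  have hL' : ∀ x ∈ ZBC p q, x ∈ BA p q → x ∈ BBC p q := fun x hx => hL x hx.1 hx.2
  have b1 : Function.Bijective (iotaBCdel p q) := by
    refine bij_subquot _ _ (fun x hx h => hL' x hx (Submodule.mem_sup_left h)) ?_
    intro x hx
    have hx0 : p x = 0 := hx
    obtain ⟨z, u, v, hz, hz', rfl⟩ := hA x (kerdel_le_ZA p q hpq hx)
    refine ⟨z + q v, ⟨?_, ?_⟩, ⟨u, by abel⟩⟩
    · simpa [hz, hpp] using hx0
    · simp [hz', hqq]
  have b2 : Function.Bijective (iotaBCdelbar p q hpq) := by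
    refine bij_subquot _ _ (fun x hx h => hL' x hx (Submodule.mem_sup_right h)) ?_
    intro x hx
    have hx0 : q x = 0 := hx
    obtain ⟨z, u, v, hz, hz', rfl⟩ := hA x (kerdelbar_le_ZA p q hx)
    refine ⟨z + p u, ⟨?_, ?_⟩, ⟨v, by abel⟩⟩
    · simp [hz, hpp]
    · simpa [hz', hqq] using hx0
  have b3 : Function.Bijective (iotaBCd p q hq) := by
    refine bij_subquot _ _ (fun x hx h => hL' x hx (ranged_le_BA p q h)) ?_
    intro x hx
    have hx0 : p x + q x = 0 := hx
    obtain ⟨z, u, v, hz, hz', rfl⟩ := hA x (kerd_le_ZA p q hp hx)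
    refine ⟨z + q (v - u), ⟨?_, ?_⟩, ⟨u, ?_⟩⟩
    · simp only [map_add, hz, hz', hpp, hqq, hqp, zero_add, add_zero] at hx0
      simpa [hz, sub_eq_add_neg] using hx0
    · simp [hz', hqq]
    · simp only [LinearMap.add_apply, map_sub]; abel
  have b4 : Function.Bijective (iotaBCA p q) := by
    refine bij_subquot _ _ hL' ?_
    intro x hx
    obtain ⟨z, u, v, hz, hz', rfl⟩ := hA x hx
    refine ⟨z, ⟨hz, hz'⟩, ?_⟩
    have : z + p u + q v - z = p u + q v := by abel
    rw [this]
    exact Submodule.add_mem_sup ⟨u, rfl⟩ ⟨v, rfl⟩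
  refine ⟨b1, b2, b3, b4, ?_, ?_, ?_⟩
  · refine (Function.Bijective.of_comp_iff _ b1).1 ?_
    convert b4 using 1
    funext m
    obtain ⟨z, rfl⟩ := Submodule.mkQ_surjective _ m
    rfl
  · refine (Function.Bijective.of_comp_iff _ b2).1 ?_
    convert b4 using 1
    funext m
    obtain ⟨z, rfl⟩ := Submodule.mkQ_surjective _ m
    rfl
  · refine (Function.Bijective.of_comp_iff _ b3).1 ?_
    convert b4 using 1
    funext m
    obtain ⟨z, rfl⟩ := Submodule.mkQ_surjective _ m
    rfl
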